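/- arXiv:1312.4750 — 2 statements merged into one kernel-verified Lean document; each statement's English description precedes it below -/
import Mathlib

section
/- There exist two group homomorphisms φ₁, φ₂ from the group of all sequences ℕ → Circle (under pointwise multiplication) to the circle group Circle such that: for every sequence f that is eventually constant with value c (i.e., f n = c for all sufficiently large n), both φ₁ f = c and φ₂ f = c; and yet for the sequence g defined by g n = (−1)ⁿ (the alternating sequence taking values 1 and −1 in the circle), φ₁ g = −1 while φ₂ g = 1. In particular, the extension of the eventual-value homomorphism from eventually constant sequences to all sequences is not unique. -/
open Filter Topology

section UltrafilterLimit

variable {ι G : Type*} [TopologicalSpace G] [CompactSpace G]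

theorem Ultrafilter.tendsto_limUnder [Nonempty G] (u : Ultrafilter ι) (f : ι → G) :
    Tendsto f u (𝓝 (limUnder (u : Filter ι) f)) :=
  tendsto_nhds_limUnder ⟨_, (u.map f).le_nhds_lim⟩

/-- The limit along an ultrafilter, as a homomorphism from families in a compact Hausdorff
topological monoid. -/
noncomputable def Ultrafilter.limHom [T2Space G] [Monoid G] [ContinuousMul G]
    (u : Ultrafilter ι) : (ι → G) →* G where
  toFun f := limUnder (u : Filter ι) f
  map_one' := tendsto_const_nhds.limUnder_eq
  map_mul' f g := ((u.tendsto_limUnder f).mul (u.tendsto_limUnder g)).limUnder_eq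

theorem Ultrafilter.limHom_eq_of_eventually_eq [T2Space G] [Monoid G] [ContinuousMul G]
    (u : Ultrafilter ι) {f : ι → G} {c : G} (h : ∀ᶠ i in (u : Filter ι), f i = c) :
    u.limHom f = c :=
  (tendsto_const_nhds.congr' (h.mono fun _ hi => hi.symm)).limUnder_eq

end UltrafilterLimit

theorem circle_net_limit_hom_not_unique :
    ∃ φ₁ φ₂ : (ℕ → Circle) →* Circle,
      (∀ (f : ℕ → Circle) (c : Circle),
        (∀ᶠ n in Filter.atTop, f n = c) → φ₁ f = c ∧ φ₂ f = c) ∧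
      (∀ g : ℕ → Circle, (∀ n, (g n : ℂ) = (-1) ^ n) →
        ((φ₁ g : ℂ) = -1 ∧ φ₂ g = 1)) := by
  have odd_atTop : Tendsto (fun n : ℕ => 2 * n + 1) (hyperfilter ℕ) atTop :=
    (tendsto_atTop_mono (fun n => by simp only [id]; lia) tendsto_id).mono_left Nat.hyperfilter_le_atTop
  have even_atTop : Tendsto (fun n : ℕ => 2 * n) (hyperfilter ℕ) atTop :=
    (tendsto_atTop_mono (fun n => by simp only [id]; lia) tendsto_id).mono_left Nat.hyperfilter_le_atTop
  refine ⟨((hyperfilter ℕ).map fun n => 2 * n + 1).limHom,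
    ((hyperfilter ℕ).map fun n => 2 * n).limHom, fun f c h => ⟨?_, ?_⟩, fun g hg => ⟨?_, ?_⟩⟩
  · exact Ultrafilter.limHom_eq_of_eventually_eq _ (odd_atTop.eventually h)
  · exact Ultrafilter.limHom_eq_of_eventually_eq _ (even_atTop.eventually h)
  · have h : ((hyperfilter ℕ).map fun n => 2 * n + 1).limHom g = g 1 :=
      Ultrafilter.limHom_eq_of_eventually_eq _
        (eventually_map.2 (Eventually.of_forall fun n =>
          Circle.ext (by simp [hg, pow_succ, pow_mul])))
    simp [h, hg]
  · exact Ultrafilter.limHom_eq_of_eventually_eq _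
      (eventually_map.2 (Eventually.of_forall fun n => Circle.ext (by simp [hg, pow_mul])))
end

section
/- Let 𝒮 be a nonempty collection of nonempty subsets of ℝ, each of which is an interval (an order-connected set), and suppose the union ⋃ 𝒮 of all sets in 𝒮 is bounded below. Then the infimum of ⋃ 𝒮 belongs to the topological closure of the set { inf J : J ∈ 𝒮 } of infima of the members of 𝒮. (Equivalently: if an interval is a union of a collection of intervals, then the left endpoint of the original interval is contained in the closure of the set of left endpoints of the intervals in the collection.) -/
/-- The infimum of a union is the greatest lower bound of the infima of its members. -/
theorem isGLB_image_sInf_sUnion {α : Type*} [ConditionallyCompleteLattice α]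
    {𝒮 : Set (Set α)} (hne : 𝒮.Nonempty) (hmem : ∀ J ∈ 𝒮, J.Nonempty)
    (hbd : BddBelow (⋃₀ 𝒮)) :
    IsGLB ((fun J => sInf J) '' 𝒮) (sInf (⋃₀ 𝒮)) := by
  constructor
  · rintro _ ⟨J, hJ, rfl⟩
    exact csInf_le_csInf hbd (hmem J hJ) (Set.subset_sUnion_of_mem hJ)
  · intro b hb
    refine le_csInf (Set.nonempty_sUnion.2 ?_) ?_
    · obtain ⟨J, hJ⟩ := hne
      exact ⟨J, hJ, hmem J hJ⟩
    · rintro x ⟨J, hJ, hx⟩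
      exact (hb (Set.mem_image_of_mem _ hJ)).trans
        (csInf_le (hbd.mono (Set.subset_sUnion_of_mem hJ)) hx)

theorem sInf_sUnion_mem_closure_of_intervals
    (𝒮 : Set (Set ℝ)) (hne : 𝒮.Nonempty)
    (hmem : ∀ J ∈ 𝒮, J.Nonempty ∧ J.OrdConnected)
    (hbd : BddBelow (⋃₀ 𝒮)) :
    sInf (⋃₀ 𝒮) ∈ closure ((fun J => sInf J) '' 𝒮) := by
  exact (isGLB_image_sInf_sUnion hne (fun J hJ => (hmem J hJ).1) hbd).mem_closure (hne.image _)
end
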